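/- Let D be a Dedekind domain, S ⊆ D a finite nonempty set, m_s a positive integer for each s ∈ S, and f = ∏_{s∈S}(x−s)^{m_s}. Suppose the fixed divisor of f is a principal ideal of D generated by c. If there exists a maximal ideal P of D with finite residue field such that, in the localization D_P with maximal ideal P·D_P, the set S is balanced and f is the equalizing polynomial of S, then c⁻¹·f is absolutely irreducible in Int(D). -/

import Mathlib

open Polynomial

section Defs

variable (R K : Type*)

/-- `Int(R) = {F ∈ K[x] ∣ F(R) ⊆ R}`, the ring of integer-valued polynomials,
as a subring of `K[x]`. -/
def intPoly [CommRing R] [CommRing K] [Algebra R K] : Subring (Polynomial K) where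
  carrier := {F | ∀ r : R, ∃ a : R, F.eval (algebraMap R K r) = algebraMap R K a}
  mul_mem' := by
    rintro f g hf hg r
    obtain ⟨a, ha⟩ := hf r
    obtain ⟨b, hb⟩ := hg r
    exact ⟨a * b, by simp [ha, hb]⟩
  one_mem' := fun r => ⟨1, by simp⟩
  add_mem' := by
    rintro f g hf hg r
    obtain ⟨a, ha⟩ := hf r
    obtain ⟨b, hb⟩ := hg r
    exact ⟨a + b, by simp [ha, hb]⟩
  zero_mem' := fun r => ⟨0, by simp⟩
  neg_mem' := by
    rintro f hf r
    obtain ⟨a, ha⟩ := hf r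
    exact ⟨-a, by simp [ha]⟩

/-- Polynomials with coefficients in `R` are integer-valued. -/
theorem map_mem_intPoly [CommRing R] [CommRing K] [Algebra R K] (f : Polynomial R) :
    f.map (algebraMap R K) ∈ intPoly R K :=
  fun r => ⟨f.eval r, by rw [Polynomial.eval_map, Polynomial.eval₂_at_apply]⟩

/-- An element `d` of a commutative monoid is absolutely irreducible if it is irreducible
and, for every `n ≥ 1`, the only factorization of `d ^ n` into irreducibles is, up to order
and unit factors, `d ⋯ d` (`n` copies). -/
def AbsolutelyIrreducible {α : Type*} [CommMonoid α] (d : α) : Prop :=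
  Irreducible d ∧ ∀ n : ℕ, 1 ≤ n → ∀ l : Multiset α, (∀ a ∈ l, Irreducible a) →
    l.prod = d ^ n → Multiset.card l = n ∧ ∀ a ∈ l, Associated a d

/-- The fixed divisor of a polynomial `f ∈ R[x]`: the ideal of `R` generated by the
values of `f` on `R`. -/
def fixDiv [CommRing R] (f : Polynomial R) : Ideal R :=
  Ideal.span (Set.range fun a => f.eval a)

/-- The fixed divisor of an integer-valued polynomial `F ∈ Int(R)`: the ideal of `R`
generated by (the elements of `R` representing) the values of `F` on `R`. -/
def fixDivK [CommRing R] [CommRing K] [Algebra R K] (F : Polynomial K) : Ideal R :=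
  Ideal.span {a : R | ∃ r : R, F.eval (algebraMap R K r) = algebraMap R K a}

/-- The (normalized additive) valuation of a nonzero element of a discrete valuation
ring: the largest `n` such that `x ∈ M ^ n`, where `M` is the maximal ideal. -/
noncomputable def mval [CommRing R] [IsLocalRing R] (x : R) : ℕ :=
  sSup {n : ℕ | x ∈ IsLocalRing.maximalIdeal R ^ n}

open scoped Classical in
/-- The valuation `v : R → ℕ∞`, with `v 0 = ⊤`. -/
noncomputable def vR [CommRing R] [IsLocalRing R] (x : R) : ℕ∞ :=
  if x = 0 then ⊤ else (mval R x : ℕ∞)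

open scoped Classical in
/-- The valuation extended to the quotient field `K`, with `v 0 = ⊤`. -/
noncomputable def vK [CommRing R] [IsLocalRing R] [CommRing K] [Algebra R K]
    [IsLocalization (nonZeroDivisors R) K] (x : K) : WithTop ℤ :=
  if x = 0 then ⊤
  else (((mval R (IsLocalization.sec (nonZeroDivisors R) x).1 : ℤ) -
        (mval R ((IsLocalization.sec (nonZeroDivisors R) x).2 : R) : ℤ) : ℤ) : WithTop ℤ)

/-- The residue class `s + M ^ n` of `s` modulo the `n`-th power of the maximal ideal. -/
def resClass [CommRing R] [IsLocalRing R] (s : R) (n : ℕ) : Set R :=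
  {x | x - s ∈ IsLocalRing.maximalIdeal R ^ n}

/-- A finite set `S ⊆ R` is balanced if, letting `n s` for each `s ∈ S` be the minimal
non-negative integer with `(s + M ^ (n s)) ∩ S = {s}`, the residue classes `s + M ^ (n s)`
(`s ∈ S`) are pairwise disjoint and cover `R`. -/
def IsBalanced [CommRing R] [IsLocalRing R] (S : Finset R) : Prop :=
  S.Nonempty ∧
  ∃ n : R → ℕ,
    (∀ s ∈ S, resClass R s (n s) ∩ (S : Set R) = {s} ∧
      ∀ k : ℕ, resClass R s k ∩ (S : Set R) = {s} → n s ≤ k) ∧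
    (∀ s ∈ S, ∀ t ∈ S, s ≠ t → Disjoint (resClass R s (n s)) (resClass R t (n t))) ∧
    (⋃ s ∈ S, resClass R s (n s)) = Set.univ

/-- `ρ` describes the `M`-adic partition `C_S` associated to `S`: the partition of `R`
into the residue classes `s + M ^ (ρ s)`, `s ∈ S`, such that each block contains both a
residue class of `M ^ (ρ s + 1)` intersecting `S` and one disjoint from `S`. -/
def IsSPartition [CommRing R] [IsLocalRing R] (S : Finset R) (ρ : R → ℕ) : Prop :=
  (⋃ s ∈ S, resClass R s (ρ s)) = Set.univ ∧
  (∀ s ∈ S, ∀ t ∈ S,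
    resClass R s (ρ s) = resClass R t (ρ t) ∨
      Disjoint (resClass R s (ρ s)) (resClass R t (ρ t))) ∧
  (∀ s ∈ S,
    (∃ u : R, resClass R u (ρ s + 1) ⊆ resClass R s (ρ s) ∧
      (resClass R u (ρ s + 1) ∩ (S : Set R)).Nonempty) ∧
    (∃ u : R, resClass R u (ρ s + 1) ⊆ resClass R s (ρ s) ∧
      resClass R u (ρ s + 1) ∩ (S : Set R) = ∅))

/-- `S'` is a balanced set associated to `S` (relative to the partition data `ρ` of `C_S`):
`S' ⊆ S` is balanced, consists of one representative per block of `C_S`, and its associated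
partition `C_{S'}` coincides with `C_S`. -/
def IsAssociatedBalancedSubset [CommRing R] [IsLocalRing R] (S S' : Finset R) (ρ : R → ℕ) :
    Prop :=
  S' ⊆ S ∧ IsBalanced R S' ∧
  (∀ s ∈ S', ∀ t ∈ S', s ≠ t → Disjoint (resClass R s (ρ s)) (resClass R t (ρ t))) ∧
  (⋃ s ∈ S', resClass R s (ρ s)) = Set.univ

open scoped Classical in
/-- The partition matrix of the partition `{s + M ^ (ρ s) : s ∈ S}`: diagonal entries
`ρ s`, off-diagonal entries `v (s - t)`. -/
noncomputable def partitionMatrix [CommRing R] [IsLocalRing R] (S : Finset R) (ρ : R → ℕ) :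
    Matrix {x // x ∈ S} {x // x ∈ S} ℤ :=
  Matrix.of fun s t =>
    if (s : R) = (t : R) then (ρ (s : R) : ℤ) else (mval R ((s : R) - (t : R)) : ℤ)

/-- `m` is the vector of multiplicities of the equalizing polynomial of `S`: the unique
vector of positive integers with gcd `1` such that `A · m = e · (1, …, 1)ᵀ` for some
non-negative integer `e`, where `A` is the partition matrix. -/
def IsEqualizingVector [CommRing R] [IsLocalRing R] (S : Finset R) (ρ : R → ℕ) (m : R → ℕ) :
    Prop :=
  (∀ s ∈ S, 0 < m s) ∧ S.gcd m = 1 ∧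
  ∃ e : ℕ, ∀ s : {x // x ∈ S},
    (∑ t : {x // x ∈ S}, partitionMatrix R S ρ s t * (m (t : R) : ℤ)) = (e : ℤ)

/-- `f` is the equalizing polynomial of `S`. -/
def IsEqualizingPoly [CommRing R] [IsLocalRing R] (S : Finset R) (f : Polynomial R) : Prop :=
  ∃ (ρ : R → ℕ) (m : R → ℕ), IsSPartition R S ρ ∧ IsEqualizingVector R S ρ m ∧
    f = ∏ s ∈ S, (Polynomial.X - Polynomial.C s) ^ m s

/-- The posh set of `f ∈ R[x]`: the set of `r ∈ R` where `v (f r)` exceeds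
`min_{t ∈ R} v (f t)`. -/
noncomputable def poshR [CommRing R] [IsLocalRing R] (f : Polynomial R) : Set R :=
  {r : R | (⨅ t : R, vR R (f.eval t)) < vR R (f.eval r)}

/-- The posh set of `F ∈ K[x]`: the set of `r ∈ R` where `v (F r)` exceeds
`min_{t ∈ R} v (F t)`. -/
def poshK [CommRing R] [IsLocalRing R] [CommRing K] [Algebra R K]
    [IsLocalization (nonZeroDivisors R) K] (F : Polynomial K) : Set R :=
  {r : R | ∃ t : R, vK R K (F.eval (algebraMap R K t)) < vK R K (F.eval (algebraMap R K r))}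

/-- `r` lies in an `S`-poor neighborhood of the partition `C_S` (described by `ρ`):
a residue class `r + M ^ (ρ s + 1)` disjoint from `S` inside a block `s + M ^ (ρ s)`. -/
def IsPoorElt [CommRing R] [IsLocalRing R] (S : Finset R) (ρ : R → ℕ) (r : R) : Prop :=
  ∃ s ∈ S, r ∈ resClass R s (ρ s) ∧ resClass R r (ρ s + 1) ∩ (S : Set R) = ∅

/-- The rich set of `S`: the union of the `S`-rich neighborhoods `s + M ^ (ρ s + 1)`,
`s ∈ S`. -/
def richSet [CommRing R] [IsLocalRing R] (S : Finset R) (ρ : R → ℕ) : Set R :=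
  ⋃ s ∈ S, resClass R s (ρ s + 1)

/-- `a` is an `M`-ordering (`P`-ordering) of `R`. -/
def IsMOrdering [CommRing R] [IsLocalRing R] (a : ℕ → R) : Prop :=
  ∀ k : ℕ, ∀ x : R,
    vR R (∏ i ∈ Finset.range k, (a k - a i)) ≤ vR R (∏ i ∈ Finset.range k, (x - a i))

end Defs

theorem sum_mul_sum_filter_nonneg {ι : Type*} (T : Finset ι) (r : ι → ι → Prop) [DecidableRel r]
    (hsymm : ∀ i ∈ T, ∀ j ∈ T, r i j → r j i)
    (htrans : ∀ i ∈ T, ∀ j ∈ T, ∀ k ∈ T, r i j → r j k → r i k) (x : ι → ℤ)  :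
    0 ≤ ∑ i ∈ T, x i * ∑ j ∈ T with r i j, x j ∧
    ∀ i ∈ T, (∀ j ∈ T, r i j ↔ j = i) →
      x i ^ 2 ≤ ∑ i ∈ T, x i * ∑ j ∈ T with r i j, x j := by
  classical
  let C : ι → Finset ι := fun i => T.filter (r i)
  have hfib : ∑ i ∈ T, x i * ∑ j ∈ T with r i j, x j =
      ∑ c ∈ T.image C, (∑ i ∈ T with C i = c, x i) * ∑ j ∈ c, x j := by
    rw [← Finset.sum_fiberwise_of_maps_to (g := C) (t := T.image C)
      (fun i hi => Finset.mem_image_of_mem _ hi)]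
    refine Finset.sum_congr rfl fun c _ => ?_
    rw [Finset.sum_mul]
    refine Finset.sum_congr rfl fun i hi => ?_
    rw [← (Finset.mem_filter.1 hi).2]
  have hterm : ∀ c ∈ T.image C, (∑ i ∈ T with C i = c, x i) * ∑ j ∈ c, x j =
      (∑ j ∈ c, x j) ^ 2 := by
    intro c hc
    obtain ⟨i, hi, rfl⟩ := Finset.mem_image.1 hc
    rcases (C i).eq_empty_or_nonempty with h | ⟨k, hk⟩
    · simp [h]
    · have : T.filter (fun j => C j = C i) = C i := by
        obtain ⟨hkT, hik⟩ := Finset.mem_filter.1 hk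
        ext j
        simp only [Finset.mem_filter, C]
        constructor
        · rintro ⟨hj, hji⟩
          refine ⟨hj, ?_⟩
          have : k ∈ T.filter (r j) := by rw [hji]; exact hk
          exact htrans i hi k hkT j hj hik (hsymm _ hj _ hkT (Finset.mem_filter.1 this).2)
        · rintro ⟨hj, hij⟩
          refine ⟨hj, Finset.filter_congr fun l hl => ⟨fun h => htrans i hi j hj l hl hij h,
            fun h => htrans j hj i hi l hl (hsymm _ hi _ hj hij) h⟩⟩
      rw [this, sq]
  rw [hfib, Finset.sum_congr rfl hterm]
  refine ⟨Finset.sum_nonneg fun c _ => sq_nonneg _, fun i hi hir => ?_⟩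
  have hCi : C i = {i} := by
    ext j
    simp only [C, Finset.mem_filter, Finset.mem_singleton]
    exact ⟨fun h => (hir j h.1).1 h.2, fun h => ⟨h ▸ hi, (hir j (h ▸ hi)).2 h⟩⟩
  have := Finset.single_le_sum (f := fun c : Finset ι => (∑ j ∈ c, x j) ^ 2)
    (fun c _ => sq_nonneg _) (Finset.mem_image_of_mem C hi)
  simpa [hCi] using this

/-- A strictly ultrametric matrix with positive diagonal has trivial kernel. -/
theorem eq_zero_of_ultrametric {ι : Type*} (T : Finset ι) (A : ι → ι → ℕ)
    (hsymm : ∀ i ∈ T, ∀ j ∈ T, A i j = A j i)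
    (hultra : ∀ i ∈ T, ∀ j ∈ T, ∀ k ∈ T, min (A i j) (A j k) ≤ A i k)
    (hdiag : ∀ i ∈ T, ∀ j ∈ T, j ≠ i → A i j < A i i)
    (hpos : ∀ i ∈ T, 0 < A i i) (x : ι → ℤ)
    (hx : ∀ i ∈ T, ∑ j ∈ T, (A i j : ℤ) * x j = 0) : ∀ i ∈ T, x i = 0 := by
  classical
  intro i₀ hi₀
  let N := ∑ i ∈ T, ∑ j ∈ T, A i j
  have hN : ∀ i ∈ T, ∀ j ∈ T, A i j ≤ N := fun i hi j hj =>
    (Finset.single_le_sum (f := fun j => A i j) (fun _ _ => Nat.zero_le _) hj).trans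
      (Finset.single_le_sum (f := fun i => ∑ j ∈ T, A i j) (fun _ _ => Nat.zero_le _) hi)
  let Q : ℕ → ℤ := fun n => ∑ i ∈ T, x i * ∑ j ∈ T with n ≤ A i j, x j
  have hQ : ∀ n, 0 ≤ Q n ∧ ∀ i ∈ T, (∀ j ∈ T, n ≤ A i j ↔ j = i) → x i ^ 2 ≤ Q n := fun n =>
    sum_mul_sum_filter_nonneg T (fun i j => n ≤ A i j)
      (fun i hi j hj h => (hsymm i hi j hj) ▸ h)
      (fun i hi j hj k hk h₁ h₂ => (le_min h₁ h₂).trans (hultra i hi j hj k hk)) x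
  have hcount : ∀ i ∈ T, ∀ j ∈ T,
      (A i j : ℤ) = ∑ n ∈ Finset.Icc 1 N, if n ≤ A i j then 1 else 0 := by
    intro i hi j hj
    rw [Finset.sum_boole]
    have : (Finset.Icc 1 N).filter (fun n => n ≤ A i j) = Finset.Icc 1 (A i j) := by
      ext n
      have := hN i hi j hj
      simp only [Finset.mem_filter, Finset.mem_Icc]
      omega
    rw [this]
    simp
  have hsum : ∑ n ∈ Finset.Icc 1 N, Q n = 0 := by
    have h0 : ∑ i ∈ T, x i * ∑ j ∈ T, (A i j : ℤ) * x j = 0 :=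
      Finset.sum_eq_zero fun i hi => by rw [hx i hi, mul_zero]
    rw [← h0, Finset.sum_comm]
    refine Finset.sum_congr rfl fun i hi => ?_
    rw [← Finset.mul_sum]
    congr 1
    simp_rw [Finset.sum_filter]
    rw [Finset.sum_comm]
    refine Finset.sum_congr rfl fun j hj => ?_
    rw [hcount i hi j hj, Finset.sum_mul]
    exact Finset.sum_congr rfl fun n _ => by split_ifs <;> simp
  have hz := (Finset.sum_eq_zero_iff_of_nonneg fun n _ => (hQ n).1).1 hsum (A i₀ i₀)
    (Finset.mem_Icc.2 ⟨hpos _ hi₀, hN _ hi₀ _ hi₀⟩)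
  have hle := (hQ (A i₀ i₀)).2 i₀ hi₀ fun j hj =>
    ⟨fun h => by_contra fun hne => absurd (hdiag _ hi₀ _ hj hne) (not_lt.2 h),
      fun h => h ▸ le_rfl⟩
  rw [hz] at hle
  exact pow_eq_zero_iff two_ne_zero |>.1 (le_antisymm hle (sq_nonneg _))

/-- Vectors with constant image under a strictly ultrametric matrix are proportional
to a primitive positive such vector. -/
theorem exists_eq_mul_of_ultrametric {ι : Type*} (T : Finset ι) (hT : T.Nonempty)
    (A : ι → ι → ℕ) (hsymm : ∀ i ∈ T, ∀ j ∈ T, A i j = A j i)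
    (hultra : ∀ i ∈ T, ∀ j ∈ T, ∀ k ∈ T, min (A i j) (A j k) ≤ A i k)
    (hdiag : ∀ i ∈ T, ∀ j ∈ T, j ≠ i → A i j < A i i)
    (m k : ι → ℕ) (hm : ∀ i ∈ T, 0 < m i) (hgcd : T.gcd m = 1) (e : ℕ) (d : ℤ)
    (he : ∀ i ∈ T, ∑ j ∈ T, A i j * m j = e)
    (hd : ∀ i ∈ T, ∑ j ∈ T, (A i j : ℤ) * k j = d) : ∃ l : ℕ, ∀ i ∈ T, k i = l * m i := by
  obtain ⟨i₀, hi₀⟩ := hT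
  by_cases hsub : ∀ j ∈ T, j = i₀
  · have hTi : T = {i₀} := Finset.eq_singleton_iff_unique_mem.2 ⟨hi₀, hsub⟩
    subst hTi
    refine ⟨k i₀, fun i hi => ?_⟩
    rw [Finset.gcd_singleton] at hgcd
    have : m i₀ = 1 := by simpa using hgcd
    rw [Finset.mem_singleton.1 hi, this, mul_one]
  push Not at hsub
  obtain ⟨j₀, hj₀, hne⟩ := hsub
  have hpos : ∀ i ∈ T, 0 < A i i := by
    intro i hi
    by_cases h : i = i₀
    · subst h; exact (Nat.zero_le _).trans_lt (hdiag i hi j₀ hj₀ hne)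
    · exact (Nat.zero_le _).trans_lt (hdiag i hi i₀ hi₀ (Ne.symm h))
  have hepos : 0 < e := by
    rw [← he i₀ hi₀]
    exact (Nat.mul_pos (hpos i₀ hi₀) (hm i₀ hi₀)).trans_le
      (Finset.single_le_sum (f := fun j => A i₀ j * m j) (fun _ _ => Nat.zero_le _) hi₀)
  have hdpos : 0 ≤ d := by
    rw [← hd i₀ hi₀]
    positivity
  lift d to ℕ using hdpos
  have hker := eq_zero_of_ultrametric T A hsymm hultra hdiag hpos
    (fun j => (e : ℤ) * k j - d * m j) fun i hi => by
      have h1 : ∑ j ∈ T, (A i j : ℤ) * m j = e := by exact_mod_cast he i hi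
      have h2 := hd i hi
      calc ∑ j ∈ T, (A i j : ℤ) * (e * k j - d * m j)
          = e * ∑ j ∈ T, (A i j : ℤ) * k j - d * ∑ j ∈ T, (A i j : ℤ) * m j := by
            rw [Finset.mul_sum, Finset.mul_sum, ← Finset.sum_sub_distrib]
            exact Finset.sum_congr rfl fun j _ => by ring
        _ = 0 := by rw [h1, h2]; ring
  have hprop : ∀ i ∈ T, e * k i = d * m i := fun i hi => by
    exact_mod_cast sub_eq_zero.1 (hker i hi)
  have hdvd : e ∣ d := by
    have : e ∣ T.gcd (fun i => d * m i) :=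
      Finset.dvd_gcd fun i hi => ⟨k i, (hprop i hi).symm⟩
    rw [Finset.gcd_mul_left, hgcd] at this
    simpa using this
  obtain ⟨l, rfl⟩ := hdvd
  refine ⟨l, fun i hi => Nat.eq_of_mul_eq_mul_left hepos ?_⟩
  rw [hprop i hi, mul_assoc]

section LocalRing

open IsLocalRing

variable {R : Type*} [CommRing R] [IsLocalRing R]

/-- `x` lies in the `n`-th power of the maximal ideal but not in the next one. -/
def ExactVal (x : R) (n : ℕ) : Prop :=
  x ∈ maximalIdeal R ^ n ∧ x ∉ maximalIdeal R ^ (n + 1)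

theorem ExactVal.ne_zero {x : R} {n : ℕ} (h : ExactVal x n) : x ≠ 0 := by
  rintro rfl
  exact h.2 (Ideal.zero_mem _)

theorem ExactVal.mem_iff {x : R} {n : ℕ} (h : ExactVal x n) (k : ℕ) :
    x ∈ maximalIdeal R ^ k ↔ k ≤ n :=
  ⟨fun hk => by
    by_contra! hlt
    exact h.2 (Ideal.pow_le_pow_right hlt hk), fun hk => Ideal.pow_le_pow_right hk h.1⟩

theorem ExactVal.unique {x : R} {n k : ℕ} (h : ExactVal x n) (h' : ExactVal x k) : n = k :=
  le_antisymm ((h'.mem_iff n).1 h.1) ((h.mem_iff k).1 h'.1)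

theorem exactVal_zero_iff {x : R} : ExactVal x 0 ↔ x ∉ maximalIdeal R := by
  simp [ExactVal]

theorem ExactVal.mul [IsDomain R] (hM : (maximalIdeal R).IsPrincipal) {x y : R} {a b : ℕ}
    (hx : ExactVal x a) (hy : ExactVal y b) : ExactVal (x * y) (a + b) := by
  obtain ⟨π, hπ⟩ := hM
  replace hπ : maximalIdeal R = Ideal.span {π} := hπ
  have hmem : ∀ (z : R) n, z ∈ maximalIdeal R ^ n ↔ π ^ n ∣ z := fun z n => by
    rw [hπ, Ideal.span_singleton_pow, Ideal.mem_span_singleton]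
  have hfac : ∀ {z : R} {n}, ExactVal z n → ∃ w, z = π ^ n * w ∧ w ∉ maximalIdeal R := by
    intro z n hz
    obtain ⟨w, rfl⟩ := (hmem z n).1 hz.1
    refine ⟨w, rfl, fun hw => hz.2 ?_⟩
    rw [pow_succ]
    exact Ideal.mul_mem_mul ((hmem _ n).2 dvd_rfl) hw
  obtain ⟨u, rfl, hu⟩ := hfac hx
  obtain ⟨w, rfl, hw⟩ := hfac hy
  have hne : π ^ (a + b) ≠ 0 := by
    rw [pow_add]
    exact mul_ne_zero (left_ne_zero_of_mul hx.ne_zero) (left_ne_zero_of_mul hy.ne_zero)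
  have heq : π ^ a * u * (π ^ b * w) = π ^ (a + b) * (u * w) := by ring
  rw [heq]
  refine ⟨(hmem _ _).2 (dvd_mul_right _ _), fun h => ?_⟩
  rw [hmem, pow_succ, mul_dvd_mul_iff_left hne, ← Ideal.mem_span_singleton, ← hπ] at h
  exact ((maximalIdeal.isMaximal R).isPrime.mem_or_mem h).elim hu hw

theorem ExactVal.pow [IsDomain R] (hM : (maximalIdeal R).IsPrincipal) {x : R} {a : ℕ}
    (hx : ExactVal x a) (n : ℕ) : ExactVal (x ^ n) (a * n) := by
  induction n with
  | zero =>
    rw [mul_zero, pow_zero, exactVal_zero_iff]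
    exact fun h => (maximalIdeal.isMaximal R).ne_top ((Ideal.eq_top_iff_one _).2 h)
  | succ n ih =>
    rw [pow_succ, mul_add_one]
    exact ih.mul hM hx

theorem ExactVal.prod [IsDomain R] (hM : (maximalIdeal R).IsPrincipal) {ι : Type*}
    (T : Finset ι) (g : ι → R) (a : ι → ℕ) (h : ∀ i ∈ T, ExactVal (g i) (a i)) :
    ExactVal (∏ i ∈ T, g i) (∑ i ∈ T, a i) := by
  classical
  induction T using Finset.induction_on with
  | empty =>
    rw [Finset.prod_empty, Finset.sum_empty, exactVal_zero_iff]
    exact fun h => (maximalIdeal.isMaximal R).ne_top ((Ideal.eq_top_iff_one _).2 h)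
  | insert i T hi ih =>
    rw [Finset.prod_insert hi, Finset.sum_insert hi]
    exact (h i (Finset.mem_insert_self _ _)).mul hM
      (ih fun j hj => h j (Finset.mem_insert_of_mem hj))

theorem exactVal_mval [IsNoetherianRing R] {x : R} (hx : x ≠ 0) : ExactVal x (mval R x) := by
  have hbdd : ∃ N, x ∉ maximalIdeal R ^ N := by
    by_contra! h
    have : x ∈ ⨅ i, maximalIdeal R ^ i := Ideal.mem_iInf.2 h
    rw [Ideal.iInf_pow_eq_bot_of_isLocalRing _ (maximalIdeal.isMaximal R).ne_top] at this
    exact hx this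
  obtain ⟨N, hN⟩ := hbdd
  have hB : BddAbove {n : ℕ | x ∈ maximalIdeal R ^ n} :=
    ⟨N, fun n hn => by
      by_contra! hlt
      exact hN (Ideal.pow_le_pow_right hlt.le hn)⟩
  refine ⟨Nat.sSup_mem (s := {n : ℕ | x ∈ maximalIdeal R ^ n}) ⟨0, by simp⟩ hB, fun h => ?_⟩
  have hle : mval R x + 1 ≤ mval R x := le_csSup hB (a := mval R x + 1) h
  omega

theorem exists_exactVal [IsNoetherianRing R] {x : R} (hx : x ≠ 0) : ∃ n, ExactVal x n :=
  ⟨_, exactVal_mval hx⟩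

/-- Distinct elements of a balanced set lie in distinct blocks of the associated partition. -/
theorem IsBalanced.sub_notMem {S : Finset R} {ρ : R → ℕ} (hbal : IsBalanced R S)
    (hρ : IsSPartition R S ρ) {s t : R} (hs : s ∈ S) (ht : t ∈ S) (hst : t ≠ s) :
    t - s ∉ maximalIdeal R ^ ρ s := by
  intro hmem
  obtain ⟨-, n, hn, -, hcov⟩ := hbal
  obtain ⟨-, u, hu, hdisj⟩ := hρ.2.2 s hs
  have hus : u - s ∈ maximalIdeal R ^ ρ s := hu (by simp [resClass])
  obtain ⟨w, hw, huw⟩ : ∃ w ∈ S, u - w ∈ maximalIdeal R ^ n w := by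
    have : u ∈ ⋃ s ∈ S, resClass R s (n s) := hcov ▸ Set.mem_univ u
    simpa [resClass] using this
  have hle : n w ≤ ρ s := by
    by_contra! hlt
    have : w ∈ resClass R u (ρ s + 1) ∩ (S : Set R) := by
      refine ⟨?_, hw⟩
      have := neg_mem (Ideal.pow_le_pow_right (Nat.succ_le_of_lt hlt) huw)
      rwa [neg_sub] at this
    rw [hdisj] at this
    exact this
  have hall : ∀ z ∈ S, z - s ∈ maximalIdeal R ^ ρ s → z = w := by
    intro z hz hzs
    have hzw : z - w ∈ maximalIdeal R ^ n w := by
      have h1 : z - u ∈ maximalIdeal R ^ n w := by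
        have := sub_mem hzs hus
        rw [sub_sub_sub_cancel_right] at this
        exact Ideal.pow_le_pow_right hle this
      have := add_mem h1 huw
      rwa [sub_add_sub_cancel] at this
    have : z ∈ resClass R w (n w) ∩ (S : Set R) := ⟨hzw, hz⟩
    rw [(hn w hw).1] at this
    exact this
  exact hst ((hall t ht hmem).trans (hall s hs (by simp)).symm)

/-- The entries of the partition matrix, as natural numbers. -/
noncomputable def partitionEntry (ρ : R → ℕ) (s t : R) : ℕ :=
  open scoped Classical in if s = t then ρ s else mval R (s - t)

theorem partitionEntry_self (ρ : R → ℕ) (s : R) : partitionEntry ρ s s = ρ s := if_pos rfl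

theorem IsEqualizingVector.sum_eq {S : Finset R} {ρ m : R → ℕ} (h : IsEqualizingVector R S ρ m) :
    ∃ e : ℕ, ∀ s ∈ S, ∑ t ∈ S, partitionEntry ρ s t * m t = e := by
  obtain ⟨-, -, e, he⟩ := h
  refine ⟨e, fun s hs => ?_⟩
  have := he ⟨s, hs⟩
  rw [← Finset.sum_coe_sort]
  zify
  rw [← this]
  refine Finset.sum_congr rfl fun t _ => ?_
  simp only [partitionMatrix, Matrix.of_apply, partitionEntry]
  split_ifs <;> rfl

variable [IsNoetherianRing R]

theorem exactVal_partitionEntry (ρ : R → ℕ) {s t : R} (h : s ≠ t) :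
    ExactVal (s - t) (partitionEntry ρ s t) := by
  rw [partitionEntry, if_neg h]
  exact exactVal_mval (sub_ne_zero.2 h)

theorem partitionEntry_comm (ρ : R → ℕ) (s t : R) :
    partitionEntry ρ s t = partitionEntry ρ t s := by
  by_cases h : s = t
  · rw [h]
  · have h1 := exactVal_partitionEntry ρ h
    have h2 := exactVal_partitionEntry ρ (Ne.symm h)
    rw [← neg_sub] at h2
    exact h1.unique ⟨neg_mem_iff.1 h2.1, fun h' => h2.2 (neg_mem h')⟩

variable {S : Finset R} {ρ : R → ℕ}

theorem partitionEntry_lt (hbal : IsBalanced R S) (hρ : IsSPartition R S ρ) {s t : R}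
    (hs : s ∈ S) (ht : t ∈ S) (hst : t ≠ s) : partitionEntry ρ s t < partitionEntry ρ s s := by
  rw [partitionEntry_self, partitionEntry_comm]
  by_contra! h
  exact hbal.sub_notMem hρ hs ht hst (((exactVal_partitionEntry ρ hst).mem_iff _).2 h)

theorem min_partitionEntry_le (hbal : IsBalanced R S) (hρ : IsSPartition R S ρ) {r s t : R}
    (hr : r ∈ S) (hs : s ∈ S) (ht : t ∈ S) :
    min (partitionEntry ρ r s) (partitionEntry ρ s t) ≤ partitionEntry ρ r t := by
  by_cases hrt : r = t
  · subst hrt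
    by_cases hsr : s = r
    · subst hsr; simp
    · exact (min_le_left _ _).trans (partitionEntry_lt hbal hρ hr hs hsr).le
  by_cases hrs : r = s
  · subst hrs; exact min_le_right _ _
  by_cases hst : s = t
  · subst hst; exact min_le_left _ _
  have h1 := ((exactVal_partitionEntry ρ hrs).mem_iff _).2
    (min_le_left _ (partitionEntry ρ s t))
  have h2 := ((exactVal_partitionEntry ρ hst).mem_iff _).2
    (min_le_right (partitionEntry ρ r s) _)
  have := add_mem h1 h2
  rw [sub_add_sub_cancel] at this
  exact ((exactVal_partitionEntry ρ hrt).mem_iff _).1 this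

/-- The elements of a suitable residue class attain the entries of a row of the
partition matrix. -/
theorem exists_forall_exactVal (hbal : IsBalanced R S) (hρ : IsSPartition R S ρ) {s : R}
    (hs : s ∈ S) : ∃ u : R, ∀ r, r - u ∈ maximalIdeal R ^ (ρ s + 1) →
      ∀ t ∈ S, ExactVal (r - t) (partitionEntry ρ s t) := by
  obtain ⟨-, u, hu, hdisj⟩ := hρ.2.2 s hs
  refine ⟨u, fun r hr t ht => ?_⟩
  have hrs : r - s ∈ maximalIdeal R ^ ρ s := hu hr
  by_cases hst : s = t
  · subst hst
    rw [partitionEntry_self]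
    refine ⟨hrs, fun h => ?_⟩
    have : s ∈ resClass R u (ρ s + 1) ∩ (S : Set R) := by
      refine ⟨?_, hs⟩
      have := sub_mem hr h
      rwa [sub_sub_sub_cancel_left] at this
    rw [hdisj] at this
    exact this
  · have h := exactVal_partitionEntry ρ hst
    have hlt := partitionEntry_lt hbal hρ hs ht (Ne.symm hst)
    rw [partitionEntry_self] at hlt
    rw [← sub_add_sub_cancel r s t]
    exact ⟨add_mem (Ideal.pow_le_pow_right hlt.le hrs) h.1, fun h' => h.2
      ((Ideal.add_mem_iff_right _ (Ideal.pow_le_pow_right hlt hrs)).1 h')⟩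

/-- Every element is congruent to those of `S` at least as the entries of some row of the
partition matrix prescribe. -/
theorem exists_forall_sub_mem_pow (hbal : IsBalanced R S) (hρ : IsSPartition R S ρ) (r : R) :
    ∃ s ∈ S, ∀ t ∈ S, r - t ∈ maximalIdeal R ^ partitionEntry ρ s t := by
  obtain ⟨s, hs, hrs⟩ : ∃ s ∈ S, r - s ∈ maximalIdeal R ^ ρ s := by
    have : r ∈ ⋃ s ∈ S, resClass R s (ρ s) := hρ.1 ▸ Set.mem_univ r
    simpa [resClass] using this
  refine ⟨s, hs, fun t ht => ?_⟩
  by_cases hst : s = t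
  · subst hst
    rwa [partitionEntry_self]
  · have hlt := partitionEntry_lt hbal hρ hs ht (Ne.symm hst)
    rw [partitionEntry_self] at hlt
    rw [← sub_add_sub_cancel r s t]
    exact add_mem (Ideal.pow_le_pow_right hlt.le hrs) (exactVal_partitionEntry ρ hst).1

end LocalRing

section Localization

open IsLocalRing

theorem count_roots_prod_X_sub_C_pow {R : Type*} [CommRing R] [IsDomain R] [DecidableEq R]
    (T : Finset R) (k : R → ℕ) {t : R} (ht : t ∈ T) :
    (∏ s ∈ T, (X - C s) ^ k s).roots.count t = k t := by
  rw [roots_prod _ _ (Finset.prod_ne_zero_iff.2 fun s _ => pow_ne_zero _ (X_sub_C_ne_zero s)),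
    Multiset.count_bind]
  simp only [roots_pow, roots_X_sub_C, Multiset.count_nsmul, Multiset.count_singleton]
  change ∑ s ∈ T, _ = _
  rw [Finset.sum_eq_single t]
  · simp
  · intro s _ hst
    simp [Ne.symm hst]
  · exact fun h => absurd ht h

theorem exists_eq_C_mul_prod_of_dvd {K : Type*} [Field K] (T : Finset K) (N : K → ℕ) {b : K}
    (hb : b ≠ 0) {G : K[X]} (hG : G ∣ C b * ∏ s ∈ T, (X - C s) ^ N s) :
    ∃ a : K, ∃ k : K → ℕ, a ≠ 0 ∧ G = C a * ∏ s ∈ T, (X - C s) ^ k s := by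
  classical
  have hprod : ∏ s ∈ T, (X - C s) ^ N s ≠ 0 :=
    Finset.prod_ne_zero_iff.2 fun s _ => pow_ne_zero _ (X_sub_C_ne_zero s)
  have hne : C b * ∏ s ∈ T, (X - C s) ^ N s ≠ 0 := mul_ne_zero (C_ne_zero.2 hb) hprod
  have hspl : (C b * ∏ s ∈ T, (X - C s) ^ N s).Splits :=
    (Splits.C b).mul (Splits.prod fun s _ => (Splits.X_sub_C s).pow _)
  have hG0 : G ≠ 0 := ne_zero_of_dvd_ne_zero hne hG
  have hsub : G.roots.toFinset ⊆ T := by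
    intro s hs
    have hroot : IsRoot (C b * ∏ s ∈ T, (X - C s) ^ N s) s :=
      (isRoot_of_mem_roots (Multiset.mem_toFinset.1 hs)).dvd hG
    rw [IsRoot, eval_mul, eval_C, eval_prod, mul_eq_zero, or_iff_right hb,
      Finset.prod_eq_zero_iff] at hroot
    obtain ⟨t, ht, h⟩ := hroot
    rw [eval_pow, eval_sub, eval_X, eval_C] at h
    rwa [sub_eq_zero.1 (eq_zero_of_pow_eq_zero h)]
  refine ⟨G.leadingCoeff, fun s => G.roots.count s, leadingCoeff_ne_zero.2 hG0, ?_⟩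
  conv_lhs => rw [(hspl.of_dvd hne hG).eq_prod_roots]
  rw [Finset.prod_multiset_map_count]
  congr 1
  refine Finset.prod_subset hsub fun s _ hs => ?_
  rw [Multiset.count_eq_zero_of_notMem (fun h => hs (Multiset.mem_toFinset.2 h)), pow_zero]

variable {D : Type*} [CommRing D] (P : Ideal D) [P.IsMaximal]

theorem exists_algebraMap_sub_mem_pow (x : Localization.AtPrime P) (n : ℕ) :
    ∃ r : D, algebraMap D (Localization.AtPrime P) r - x ∈
      maximalIdeal (Localization.AtPrime P) ^ n := by
  obtain ⟨⟨a, b⟩, hx⟩ := IsLocalization.surj P.primeCompl x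
  have hcop : IsCoprime (Ideal.span {(b : D)}) (P ^ n) := by
    refine IsCoprime.pow_right ?_
    rw [Ideal.isCoprime_iff_sup_eq, sup_comm]
    refine Ideal.IsMaximal.out.2 _ (left_lt_sup.2 fun h => b.2 ?_)
    exact h (Ideal.mem_span_singleton_self _)
  obtain ⟨y, hy, z, hz, hyz⟩ := Ideal.isCoprime_iff_exists.1 hcop
  obtain ⟨w, rfl⟩ := Ideal.mem_span_singleton'.1 hy
  refine ⟨a * w, ?_⟩
  have hzm : algebraMap D (Localization.AtPrime P) z ∈
      maximalIdeal (Localization.AtPrime P) ^ n := by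
    rw [← Localization.AtPrime.map_eq_maximalIdeal, ← Ideal.map_pow]
    exact Ideal.mem_map_of_mem _ hz
  have h1 := congrArg (algebraMap D (Localization.AtPrime P)) hyz
  simp only [map_add, map_mul, map_one] at h1 hx ⊢
  rw [← hx]
  have : x * algebraMap D _ (b : D) * algebraMap D _ w - x =
      -x * algebraMap D (Localization.AtPrime P) z := by
    linear_combination x * h1
  rw [this]
  exact Ideal.mul_mem_left _ _ hzm

variable [IsDedekindDomain D]

theorem maximalIdeal_isPrincipal_localization :
    (maximalIdeal (Localization.AtPrime P)).IsPrincipal := by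
  have : IsDedekindDomain (Localization.AtPrime P) :=
    IsLocalization.isDedekindDomain D P.primeCompl_le_nonZeroDivisors _
  exact maximalIdeal_isPrincipal_of_isDedekindDomain _

open scoped Classical in
/-- The arithmetic of the partition matrix of a balanced set in a localization, transported
to the base ring. -/
theorem exists_partition_data (S : Finset D) (m : D → ℕ)
    (hbal : IsBalanced (Localization.AtPrime P)
      (S.image (algebraMap D (Localization.AtPrime P))))
    (heq : IsEqualizingPoly (Localization.AtPrime P)
      (S.image (algebraMap D (Localization.AtPrime P)))
      ((∏ s ∈ S, (X - C s) ^ m s).map (algebraMap D (Localization.AtPrime P)))) :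
    ∃ (A : D → D → ℕ) (e : ℕ), (∀ s ∈ S, ∀ t ∈ S, A s t = A t s) ∧
      (∀ r ∈ S, ∀ s ∈ S, ∀ t ∈ S, min (A r s) (A s t) ≤ A r t) ∧
      (∀ s ∈ S, ∀ t ∈ S, t ≠ s → A s t < A s s) ∧ S.gcd m = 1 ∧
      (∀ s ∈ S, ∑ t ∈ S, A s t * m t = e) ∧
      (∀ r : D, algebraMap D (Localization.AtPrime P) (∏ t ∈ S, (r - t) ^ m t) ∈
        maximalIdeal (Localization.AtPrime P) ^ e) ∧
      ∀ s ∈ S, ∃ r : D, ∀ t ∈ S,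
        ExactVal (algebraMap D (Localization.AtPrime P) (r - t)) (A s t) := by
  set R := Localization.AtPrime P
  set φ := algebraMap D R
  have hφ : Function.Injective φ :=
    IsLocalization.injective R P.primeCompl_le_nonZeroDivisors
  have : IsDomain R := IsLocalization.isDomain_localization P.primeCompl_le_nonZeroDivisors
  have : IsNoetherianRing R := IsLocalization.isNoetherianRing P.primeCompl R inferInstance
  obtain ⟨ρ, m', hρ, hvec, hprod⟩ := heq
  have hm' : ∀ s ∈ S, m' (φ s) = m s := by
    intro s hs
    have h1 := count_roots_prod_X_sub_C_pow (S.image φ) m' (Finset.mem_image_of_mem φ hs)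
    rw [← hprod, Polynomial.map_prod] at h1
    have h2 : ∏ s ∈ S, ((X - C s) ^ m s).map φ =
        ∏ x ∈ S.image φ, (X - C x) ^ m (Function.invFun φ x) := by
      rw [Finset.prod_image hφ.injOn]
      refine Finset.prod_congr rfl fun t _ => ?_
      rw [Function.leftInverse_invFun hφ t]
      simp
    rw [h2, count_roots_prod_X_sub_C_pow (S.image φ) _ (Finset.mem_image_of_mem φ hs),
      Function.leftInverse_invFun hφ s] at h1
    exact h1.symm
  have hmem : ∀ {s}, s ∈ S → φ s ∈ S.image φ := fun h => Finset.mem_image_of_mem φ h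
  obtain ⟨e, he⟩ := hvec.sum_eq
  have hsum : ∀ s ∈ S, ∑ t ∈ S, partitionEntry ρ (φ s) (φ t) * m t = e := by
    intro s hs
    rw [← he _ (hmem hs), Finset.sum_image hφ.injOn]
    exact Finset.sum_congr rfl fun t ht => by rw [hm' t ht]
  refine ⟨fun s t => partitionEntry ρ (φ s) (φ t), e, fun s _ t _ => partitionEntry_comm ρ _ _,
    fun r hr s hs t ht => min_partitionEntry_le hbal hρ (hmem hr) (hmem hs) (hmem ht),
    fun s hs t ht hts => partitionEntry_lt hbal hρ (hmem hs) (hmem ht) (hφ.ne hts), ?_,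
    hsum, fun r => ?_, fun s hs => ?_⟩
  · rw [← hvec.2.1, Finset.gcd_image]
    exact Finset.gcd_congr rfl fun t ht => (hm' t ht).symm
  · obtain ⟨x, hx, hr⟩ := exists_forall_sub_mem_pow hbal hρ (φ r)
    obtain ⟨s, hs, rfl⟩ := Finset.mem_image.1 hx
    rw [← hsum s hs, map_prod, ← Finset.prod_pow_eq_pow_sum]
    refine Ideal.prod_mem_prod fun t ht => ?_
    rw [map_pow, map_sub, pow_mul]
    exact Ideal.pow_mem_pow (hr _ (hmem ht)) _
  · obtain ⟨u, hu⟩ := exists_forall_exactVal hbal hρ (hmem hs)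
    obtain ⟨r, hr⟩ := exists_algebraMap_sub_mem_pow P u (ρ (φ s) + 1)
    exact ⟨r, fun t ht => by rw [map_sub]; exact hu _ hr _ (hmem ht)⟩

end Localization

theorem absolutelyIrreducible_of_forall_associated_pow {α : Type*} [CommRing α] [IsDomain α]
    {d : α} (h0 : d ≠ 0) (hu : ¬ IsUnit d)
    (h : ∀ (n : ℕ) (a b : α), a * b = d ^ n → ∃ l : ℕ, Associated a (d ^ l)) :
    AbsolutelyIrreducible d := by
  have hinj : ∀ {i j : ℕ}, Associated (d ^ i) (d ^ j) → i = j := fun hij =>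
    le_antisymm ((pow_dvd_pow_iff h0 hu).1 hij.dvd) ((pow_dvd_pow_iff h0 hu).1 hij.symm.dvd)
  refine ⟨⟨hu, fun a b hab => ?_⟩, fun n _ l hl hprod => ?_⟩
  · obtain ⟨i, hi⟩ := h 1 a b (by rw [pow_one, hab])
    obtain ⟨j, hj⟩ := h 1 b a (by rw [pow_one, hab, mul_comm])
    have hij := hi.mul_mul hj
    rw [← hab, ← pow_add, ← pow_one d, ← pow_mul] at hij
    have := hinj hij
    rcases Nat.eq_zero_or_pos i with rfl | hipos
    · left
      rw [pow_zero] at hi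
      exact associated_one_iff_isUnit.1 hi
    · right
      obtain rfl : j = 0 := by omega
      rw [pow_zero] at hj
      exact associated_one_iff_isUnit.1 hj
  · have hassoc : ∀ a ∈ l, Associated a d := by
      intro a ha
      obtain ⟨l', rfl⟩ := Multiset.exists_cons_of_mem ha
      rw [Multiset.prod_cons] at hprod
      obtain ⟨k, hk⟩ := h n a _ hprod
      have hirr := hk.irreducible_iff.1 (hl a ha)
      have : k = 1 := by_contra fun hne => not_irreducible_pow hne hirr
      rwa [this, pow_one] at hk
    refine ⟨hinj ?_, hassoc⟩
    rw [← hprod]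
    clear hprod hl
    induction l using Multiset.induction_on with
    | empty => simp
    | cons a l ih =>
      rw [Multiset.card_cons, Multiset.prod_cons, pow_succ, mul_comm a]
      exact (ih fun b hb => hassoc b (Multiset.mem_cons_of_mem hb)).mul_mul
        (hassoc a (Multiset.mem_cons_self a l)).symm

section FixedDivisor

variable {D : Type*} [CommRing D] {K : Type*} [Field K] [Algebra D K]
  [IsFractionRing D K] {f : D[X]} {c : D}

theorem exists_eval_eq_mul (hc : fixDiv D f = Ideal.span {c}) (r : D) :
    ∃ q, f.eval r = c * q :=
  Ideal.mem_span_singleton.1 (hc ▸ Ideal.subset_span ⟨r, rfl⟩)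

theorem eval_inv_mul_map (hc0 : c ≠ 0) {r q : D} (h : f.eval r = c * q) :
    (C (algebraMap D K c)⁻¹ * f.map (algebraMap D K)).eval (algebraMap D K r) =
      algebraMap D K q := by
  have hc' : algebraMap D K c ≠ 0 :=
    (map_ne_zero_iff _ (IsFractionRing.injective D K)).2 hc0
  rw [eval_mul, eval_C, eval_map_apply, h, map_mul, inv_mul_cancel_left₀ hc']

variable [IsDomain D]

/-- Scalar multiples of powers of a polynomial with trivial fixed divisor are integer-valued
only for integral scalars. -/
theorem exists_algebraMap_eq_of_mem_intPoly (hc : fixDiv D f = Ideal.span {c}) (hc0 : c ≠ 0)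
    (a : K) (l : ℕ)
    (h : C a * (C (algebraMap D K c)⁻¹ * f.map (algebraMap D K)) ^ l ∈ intPoly D K) :
    ∃ b, algebraMap D K b = a := by
  choose q hq using exists_eval_eq_mul hc
  have htop : Ideal.span (Set.range q) = ⊤ := by
    rw [Ideal.eq_top_iff_one]
    have hmem : c ∈ fixDiv D f := hc ▸ Ideal.mem_span_singleton_self c
    have hle : fixDiv D f ≤ Ideal.span {c} * Ideal.span (Set.range q) := by
      refine Ideal.span_le.2 ?_
      rintro _ ⟨r, rfl⟩
      simp only [hq]
      exact Ideal.mul_mem_mul (Ideal.mem_span_singleton_self c) (Ideal.subset_span ⟨r, rfl⟩)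
    obtain ⟨z, hz, hcz⟩ := Ideal.mem_span_singleton_mul.1 (hle hmem)
    rwa [mul_left_cancel₀ hc0 (hcz.trans (mul_one c).symm)] at hz
  have h1 : (1 : D) ∈ Ideal.span ((fun x => x ^ l) '' Set.range q) := by
    rw [Ideal.span_pow_eq_top _ htop]
    trivial
  suffices H : ∀ x ∈ Ideal.span ((fun x => x ^ l) '' Set.range q),
      ∃ b, algebraMap D K b = a * algebraMap D K x by
    simpa using H 1 h1
  intro x hx
  induction hx using Submodule.span_induction with
  | mem x hx =>
    obtain ⟨_, ⟨r, rfl⟩, rfl⟩ := hx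
    obtain ⟨b, hb⟩ := h r
    rw [eval_mul, eval_C, eval_pow, eval_inv_mul_map hc0 (hq r)] at hb
    exact ⟨b, by rw [← hb, map_pow]⟩
  | zero => exact ⟨0, by simp⟩
  | add x y _ _ hx hy =>
    obtain ⟨b, hb⟩ := hx
    obtain ⟨b', hb'⟩ := hy
    exact ⟨b + b', by rw [map_add, hb, hb', map_add, mul_add]⟩
  | smul y x _ hx =>
    obtain ⟨b, hb⟩ := hx
    exact ⟨y * b, by rw [map_mul, hb, smul_eq_mul, map_mul, mul_left_comm]⟩

end FixedDivisor

section Factorization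

open IsLocalRing

variable {D : Type*} [CommRing D] [IsDedekindDomain D] {K : Type*} [Field K] [Algebra D K]
  [IsFractionRing D K] {S : Finset D} {m : D → ℕ} {c : D} {P : Ideal D} [P.IsMaximal]

open scoped Classical in
/-- Integer-valued divisors of powers of the normalized equalizing polynomial are scalar
multiples of powers of it. -/
theorem exists_eq_C_mul_pow (hSne : S.Nonempty) (hm : ∀ s ∈ S, 0 < m s)
    (hc : fixDiv D (∏ s ∈ S, (X - C s) ^ m s) = Ideal.span {c})
    (hbal : IsBalanced (Localization.AtPrime P)
      (S.image (algebraMap D (Localization.AtPrime P))))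
    (heq : IsEqualizingPoly (Localization.AtPrime P)
      (S.image (algebraMap D (Localization.AtPrime P)))
      ((∏ s ∈ S, (X - C s) ^ m s).map (algebraMap D (Localization.AtPrime P)))) :
    c ≠ 0 ∧ ∀ (n : ℕ) (G H : K[X]), G ∈ intPoly D K → H ∈ intPoly D K →
      G * H = (C (algebraMap D K c)⁻¹ *
        (∏ s ∈ S, (X - C s) ^ m s).map (algebraMap D K)) ^ n →
      ∃ (a : K) (l : ℕ), G = C a * (C (algebraMap D K c)⁻¹ *
        (∏ s ∈ S, (X - C s) ^ m s).map (algebraMap D K)) ^ l := by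
  obtain ⟨A, e, hsymm, hultra, hdiag, hgcd, hsum, hmin, hpoor⟩ :=
    exists_partition_data P S m hbal heq
  clear heq hbal
  set f : D[X] := ∏ s ∈ S, (X - C s) ^ m s with hf
  set R := Localization.AtPrime P
  set φ := algebraMap D R
  set ψ := algebraMap D K
  have hφ : Function.Injective φ :=
    IsLocalization.injective R P.primeCompl_le_nonZeroDivisors
  have hψ : Function.Injective ψ := IsFractionRing.injective D K
  have : IsDomain R := IsLocalization.isDomain_localization P.primeCompl_le_nonZeroDivisors
  have : IsNoetherianRing R := IsLocalization.isNoetherianRing P.primeCompl R inferInstance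
  have hprin := maximalIdeal_isPrincipal_localization P
  have hev : ∀ r, f.eval r = ∏ t ∈ S, (r - t) ^ m t := fun r => by
    simp [hf, eval_prod]
  have hex : ∀ {s r : D}, (∀ t ∈ S, ExactVal (φ (r - t)) (A s t)) → ∀ k : D → ℕ,
      ExactVal (φ (∏ t ∈ S, (r - t) ^ k t)) (∑ t ∈ S, A s t * k t) := by
    intro s r hr k
    rw [map_prod]
    refine ExactVal.prod hprin _ _ _ fun t ht => ?_
    rw [map_pow]
    exact (hr t ht).pow hprin _
  have hfr : ∀ s ∈ S, ∀ r, (∀ t ∈ S, ExactVal (φ (r - t)) (A s t)) →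
      ExactVal (φ (f.eval r)) e := by
    intro s hs r hr
    rw [← hsum s hs, hev]
    exact hex hr m
  have hc0 : c ≠ 0 := by
    rintro rfl
    obtain ⟨s, hs⟩ := hSne
    obtain ⟨r, hr⟩ := hpoor s hs
    obtain ⟨q, hq⟩ := exists_eval_eq_mul hc r
    have := (hfr s hs r hr).ne_zero
    rw [hq, zero_mul, map_zero] at this
    exact this rfl
  have hψc : ψ c ≠ 0 := (map_ne_zero_iff _ hψ).2 hc0
  refine ⟨hc0, fun n G H hG hH hGH => ?_⟩
  have hmap : ∀ k : D → ℕ, (∏ s ∈ S, (X - C (ψ s)) ^ k s : K[X]) =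
      ∏ x ∈ S.image ψ, (X - C x) ^ k (Function.invFun ψ x) := fun k => by
    rw [Finset.prod_image hψ.injOn]
    exact Finset.prod_congr rfl fun t _ => by rw [Function.leftInverse_invFun hψ t]
  have hfmap : f.map ψ = ∏ s ∈ S, (X - C (ψ s)) ^ m s := by
    simp [hf, Polynomial.map_prod]
  obtain ⟨a, k, ha, hGk⟩ : ∃ (a : K) (k : D → ℕ), a ≠ 0 ∧
      G = C a * ∏ s ∈ S, (X - C (ψ s)) ^ k s := by
    have hdvd : G ∣ C ((ψ c)⁻¹ ^ n) * ∏ x ∈ S.image ψ,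
        (X - C x) ^ (m (Function.invFun ψ x) * n) := by
      refine ⟨H, ?_⟩
      rw [hGH, hfmap, mul_pow, C_pow, ← Finset.prod_pow]
      simp_rw [← pow_mul]
      rw [hmap fun s => m s * n]
    obtain ⟨a, k, ha, h⟩ :=
      exists_eq_C_mul_prod_of_dvd _ _ (pow_ne_zero _ (inv_ne_zero hψc)) hdvd
    exact ⟨a, fun s => k (ψ s), ha, by rw [h, Finset.prod_image hψ.injOn]⟩
  obtain ⟨p, q, hq, hpq⟩ := IsFractionRing.div_surjective (A := D) a
  have hq0 : q ≠ 0 := nonZeroDivisors.ne_zero hq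
  have hψq : ψ q ≠ 0 := (map_ne_zero_iff _ hψ).2 hq0
  have hp0 : p ≠ 0 := by
    rintro rfl
    exact ha (by rw [← hpq, map_zero, zero_div])
  obtain ⟨vp, hvp⟩ := exists_exactVal ((map_ne_zero_iff φ hφ).2 hp0)
  obtain ⟨vq, hvq⟩ := exists_exactVal ((map_ne_zero_iff φ hφ).2 hq0)
  obtain ⟨vc, hvc⟩ := exists_exactVal ((map_ne_zero_iff φ hφ).2 hc0)
  have hevc : e ≤ vc := by
    rw [← hvc.mem_iff, ← Ideal.mem_comap]
    have hle : fixDiv D f ≤ (maximalIdeal R ^ e).comap φ := by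
      refine Ideal.span_le.2 ?_
      rintro _ ⟨r, rfl⟩
      simp only [hev]
      exact hmin r
    exact hle (hc ▸ Ideal.mem_span_singleton_self c)
  have hk : ∀ s ∈ S, ∑ t ∈ S, (A s t : ℤ) * k t = (vq : ℤ) - vp := by
    intro s hs
    obtain ⟨r, hr⟩ := hpoor s hs
    obtain ⟨d, hd⟩ := exists_eval_eq_mul hc r
    obtain ⟨g, hg⟩ := hG r
    obtain ⟨h, hh⟩ := hH r
    have hfe := hfr s hs r hr
    have hd0 : φ d ≠ 0 := by
      intro h0
      rw [hd, map_mul, h0, mul_zero] at hfe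
      exact hfe.ne_zero rfl
    obtain ⟨vd, hvd⟩ := exists_exactVal hd0
    have hvcd := hvc.mul hprin hvd
    rw [← map_mul, ← hd] at hvcd
    have hvd0 : vd = 0 := by
      have := hvcd.unique hfe
      omega
    rw [hvd0] at hvd
    have hgh : g * h = d ^ n := by
      apply hψ
      have := congrArg (eval (ψ r)) hGH
      rw [eval_mul, hg, hh, eval_pow, eval_inv_mul_map hc0 hd] at this
      rw [map_mul, this, map_pow]
    have hvg : ExactVal (φ g) 0 := by
      rw [exactVal_zero_iff]
      intro hgM
      have hdn := hvd.pow hprin n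
      rw [zero_mul, exactVal_zero_iff, ← map_pow, ← hgh, map_mul] at hdn
      exact hdn (Ideal.mul_mem_right _ _ hgM)
    have hqg : q * g = p * ∏ t ∈ S, (r - t) ^ k t := by
      apply hψ
      rw [hGk, ← hpq, eval_mul, eval_C, eval_prod] at hg
      simp only [eval_pow, eval_sub, eval_X, eval_C] at hg
      rw [div_mul_eq_mul_div, div_eq_iff hψq] at hg
      rw [map_mul, map_mul, map_prod, mul_comm]
      simp only [map_pow, map_sub]
      exact hg.symm
    have h1 := hvq.mul hprin hvg
    have h2 := hvp.mul hprin (hex hr k)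
    rw [← map_mul] at h1 h2
    rw [hqg] at h1
    have h3 := h1.unique h2
    zify at h3
    linarith
  obtain ⟨l, hl⟩ := exists_eq_mul_of_ultrametric S hSne A hsymm hultra hdiag m k hm hgcd e _
    hsum hk
  refine ⟨a * ψ c ^ l, l, ?_⟩
  rw [hGk, hfmap, mul_pow, ← C_pow, ← mul_assoc, ← C_mul, mul_assoc, ← mul_pow,
    mul_inv_cancel₀ hψc, one_pow, mul_one, ← Finset.prod_pow]
  congr 1
  refine Finset.prod_congr rfl fun s hs => ?_
  rw [hl s hs, ← pow_mul, mul_comm]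

end Factorization

open scoped Classical in
/-- Let `D` be a Dedekind domain, `f = ∏_{s ∈ S}(x - s)^{m s}` with fixed
divisor generated by `c`. If there is a maximal ideal `P` of `D` with finite residue field
such that `S` is balanced in `D_P` and `f` is the equalizing polynomial of `S` there, then
`c⁻¹ · f` is absolutely irreducible in `Int(D)`. -/
theorem statement5 (D : Type*) [CommRing D] [IsDomain D] [IsDedekindDomain D]
    (K : Type*) [Field K] [Algebra D K] [IsFractionRing D K]
    (S : Finset D) (hSne : S.Nonempty) (m : D → ℕ) (hm : ∀ s ∈ S, 0 < m s)
    (f : Polynomial D) (hfdef : f = ∏ s ∈ S, (Polynomial.X - Polynomial.C s) ^ m s)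
    (c : D) (hc : fixDiv D f = Ideal.span {c})
    (P : Ideal D) [P.IsMaximal] [Finite (D ⧸ P)]
    (hbal : IsBalanced (Localization.AtPrime P)
      (S.image (algebraMap D (Localization.AtPrime P))))
    (heq : IsEqualizingPoly (Localization.AtPrime P)
      (S.image (algebraMap D (Localization.AtPrime P)))
      (f.map (algebraMap D (Localization.AtPrime P)))) :
    ∃ hF : Polynomial.C (algebraMap D K c)⁻¹ * f.map (algebraMap D K) ∈ intPoly D K,
      AbsolutelyIrreducible
        (⟨Polynomial.C (algebraMap D K c)⁻¹ * f.map (algebraMap D K), hF⟩ : intPoly D K) := by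
  subst hfdef
  obtain ⟨hc0, hfac⟩ := exists_eq_C_mul_pow (K := K) hSne hm hc hbal heq
  set F : K[X] := C (algebraMap D K c)⁻¹ *
    (∏ s ∈ S, (X - C s) ^ m s).map (algebraMap D K) with hFdef
  have hF : F ∈ intPoly D K := fun r => by
    obtain ⟨q, hq⟩ := exists_eval_eq_mul hc r
    exact ⟨q, eval_inv_mul_map hc0 hq⟩
  have hψ : Function.Injective (algebraMap D K) := IsFractionRing.injective D K
  have hF0 : F ≠ 0 := by
    refine mul_ne_zero (C_ne_zero.2 (inv_ne_zero ((map_ne_zero_iff _ hψ).2 hc0))) ?_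
    rw [Polynomial.map_ne_zero_iff hψ]
    exact Finset.prod_ne_zero_iff.2 fun s _ => pow_ne_zero _ (X_sub_C_ne_zero s)
  have hFu : ¬ IsUnit F := by
    intro hu
    obtain ⟨s, hs⟩ := hSne
    have hroot : F.eval (algebraMap D K s) = 0 := by
      rw [hFdef, eval_inv_mul_map hc0 (q := 0), map_zero]
      rw [mul_zero, eval_prod]
      exact Finset.prod_eq_zero hs (by simp [(hm s hs).ne'])
    have := hu.map (evalRingHom (algebraMap D K s))
    rw [coe_evalRingHom, hroot] at this
    exact not_isUnit_zero this
  refine ⟨hF, absolutelyIrreducible_of_forall_associated_pow (fun h => hF0 ?_)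
    (fun h => hFu ?_) fun n G H hGH => ?_⟩
  · exact congrArg Subtype.val h
  · exact h.map (intPoly D K).subtype
  · have hGH' : (G : K[X]) * H = F ^ n := congrArg Subtype.val hGH
    obtain ⟨a, l, hG⟩ := hfac n G H G.2 H.2 hGH'
    obtain ⟨b, k, hH⟩ := hfac n H G H.2 G.2 (by rw [mul_comm, hGH'])
    obtain ⟨a, rfl⟩ := exists_algebraMap_eq_of_mem_intPoly hc hc0 a l (hG ▸ G.2)
    obtain ⟨b, rfl⟩ := exists_algebraMap_eq_of_mem_intPoly hc hc0 b k (hH ▸ H.2)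
    rw [hG, hH] at hGH'
    have hab : C (algebraMap D K a) * C (algebraMap D K b) * F ^ (l + k) = F ^ n := by
      rw [← hGH']; ring
    have hab0 : C (algebraMap D K a * algebraMap D K b) ≠ 0 := by
      intro h0
      rw [← C_mul, h0, zero_mul] at hab
      exact pow_ne_zero n hF0 hab.symm
    have hassoc : Associated (F ^ (l + k)) (F ^ n) := by
      rw [← hab, ← C_mul]
      exact (associated_unit_mul_left _ _ (isUnit_C.2 (C_ne_zero.1 hab0).isUnit)).symm
    have hlk : l + k = n := le_antisymm ((pow_dvd_pow_iff hF0 hFu).1 hassoc.dvd)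
      ((pow_dvd_pow_iff hF0 hFu).1 hassoc.symm.dvd)
    rw [hlk, ← C_mul, ← map_mul] at hab
    have hab1 : a * b = 1 := by
      apply hψ
      rw [map_one]
      exact C_injective ((mul_eq_right₀ (pow_ne_zero n hF0)).1 hab)
    have hC : ∀ x : D, C (algebraMap D K x) ∈ intPoly D K := fun x r => ⟨x, eval_C⟩
    have hunit : IsUnit (⟨C (algebraMap D K a), hC a⟩ : intPoly D K) :=
      IsUnit.of_mul_eq_one ⟨C (algebraMap D K b), hC b⟩
        (Subtype.ext (by simp [← map_mul, hab1]))
    have hGeq : G = ⟨C (algebraMap D K a), hC a⟩ * (⟨F, hF⟩ : intPoly D K) ^ l :=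
      Subtype.ext hG
    rw [hGeq]
    exact ⟨l, associated_unit_mul_left _ _ hunit⟩
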